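/- arXiv:1811.01600 — 2 statements merged into one kernel-verified Lean document; each statement's English description precedes it below -/
import Mathlib

section
/- For any matroid M = ([n], 𝓘) with n ≥ 2, the quadratic polynomial ∂_y^{n−2} g_M, where g_M(y, z_1, …, z_n) = Σ_{I ∈ 𝓘} y^{n−|I|} · Π_{i ∈ I} z_i, is log-concave over ℝ_{≥0}^{n+1}. Explicitly, the quadratic (n(n−1)/2)·y^2 + (n−1)·Σ_{{i} ∈ 𝓘} y·z_i + Σ_{{i,j} ∈ 𝓘} z_i·z_j is log-concave over ℝ_{≥0}^{n+1}. -/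
open Matrix MvPolynomial

structure PaperMatroid (n : ℕ) where
  Indep : Finset (Fin n) → Prop
  indep_nonempty : ∃ S, Indep S
  indep_subset : ∀ ⦃S T : Finset (Fin n)⦄, S ⊆ T → Indep T → Indep S
  indep_exchange : ∀ ⦃S T : Finset (Fin n)⦄, Indep S → Indep T → S.card < T.card →
    ∃ i ∈ T \ S, Indep (insert i S)

/-- `f` is nonnegative and log-concave as a function on the nonnegative orthant. -/
def LogConcaveOn {m : ℕ} (f : MvPolynomial (Fin m) ℝ) : Prop :=
  (∀ x : Fin m → ℝ, (∀ i, 0 ≤ x i) → 0 ≤ MvPolynomial.eval x f) ∧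
  ∀ u v : Fin m → ℝ, (∀ i, 0 ≤ u i) → (∀ i, 0 ≤ v i) →
    ∀ t : ℝ, 0 ≤ t → t ≤ 1 →
      (MvPolynomial.eval u f) ^ t * (MvPolynomial.eval v f) ^ (1 - t) ≤
        MvPolynomial.eval (fun i => t * u i + (1 - t) * v i) f

/- The homogenized independent-set generating polynomial
`g_M(y, z_1, …, z_n) = ∑_{I ∈ 𝓘} y^(n - |I|) ∏_{i ∈ I} z_i`,
where variable `0` is `y` and variable `i.succ` is `z_i`. -/
open Classical in
noncomputable def gM {n : ℕ} (M : PaperMatroid n) : MvPolynomial (Fin (n+1)) ℝ :=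
  ∑ S : Finset (Fin n),
    if M.Indep S then
      MvPolynomial.X 0 ^ (n - S.card) * ∏ i ∈ S, MvPolynomial.X i.succ
    else 0

theorem LogConcaveOn.C_mul {m : ℕ} {f : MvPolynomial (Fin m) ℝ} (hf : LogConcaveOn f) {c : ℝ}
    (hc : 0 ≤ c) : LogConcaveOn (MvPolynomial.C c * f) := by
  refine ⟨fun x hx => ?_, fun u v hu hv t ht ht' => ?_⟩
  · simpa using mul_nonneg hc (hf.1 x hx)
  · simp only [map_mul, eval_C]
    rw [Real.mul_rpow hc (hf.1 u hu), Real.mul_rpow hc (hf.1 v hv), mul_mul_mul_comm,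
      ← Real.rpow_add_of_nonneg hc ht (sub_nonneg.2 ht'), add_sub_cancel, Real.rpow_one]
    exact mul_le_mul_of_nonneg_left (hf.2 u v hu hv t ht ht') hc

/-- The reverse Cauchy–Schwarz inequality for a form of Lorentzian signature. -/
theorem sqrt_mul_sqrt_le_lorentz {ι : Type*} (s : Finset ι) {a b p q : ℝ} (f g : ι → ℝ)
    (ha : 0 ≤ a) (hb : 0 ≤ b) (hp : 0 ≤ p) (hq : 0 ≤ q)
    (hpa : p = a ^ 2 - ∑ k ∈ s, f k ^ 2) (hqb : q = b ^ 2 - ∑ k ∈ s, g k ^ 2) :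
    √p * √q ≤ a * b - ∑ k ∈ s, f k * g k := by
  have hF : 0 ≤ ∑ k ∈ s, f k ^ 2 := Finset.sum_nonneg fun _ _ => sq_nonneg _
  have hG : 0 ≤ ∑ k ∈ s, g k ^ 2 := Finset.sum_nonneg fun _ _ => sq_nonneg _
  have hCS := Real.sum_mul_le_sqrt_mul_sqrt s f g
  set F := ∑ k ∈ s, f k ^ 2
  set G := ∑ k ∈ s, g k ^ 2
  have hab : √p * √q + √F * √G ≤ a * b := by
    apply abs_le_of_sq_le_sq' _ (mul_nonneg ha hb) |>.2
    have ha2 : a ^ 2 = √p ^ 2 + √F ^ 2 := by rw [Real.sq_sqrt hp, Real.sq_sqrt hF]; linarith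
    have hb2 : b ^ 2 = √q ^ 2 + √G ^ 2 := by rw [Real.sq_sqrt hq, Real.sq_sqrt hG]; linarith
    rw [mul_pow, ha2, hb2]
    nlinarith [sq_nonneg (√p * √G - √q * √F)]
  linarith

/-- A quadratic form which is a square of a linear form minus a sum of squares is log-concave on
the orthant as soon as it and the linear form are nonnegative there. -/
theorem logConcaveOn_of_lorentz {m : ℕ} {ι : Type*} (s : Finset ι) {f : MvPolynomial (Fin m) ℝ}
    (l : (Fin m → ℝ) →ₗ[ℝ] ℝ) (N : ι → (Fin m → ℝ) →ₗ[ℝ] ℝ)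
    (hf : ∀ x : Fin m → ℝ, (∀ i, 0 ≤ x i) → 0 ≤ eval x f)
    (hl : ∀ x : Fin m → ℝ, (∀ i, 0 ≤ x i) → 0 ≤ l x)
    (h : ∀ x, eval x f = l x ^ 2 - ∑ k ∈ s, N k x ^ 2) : LogConcaveOn f := by
  refine ⟨hf, fun u v hu hv t ht ht' => ?_⟩
  have hsum : (fun i => t * u i + (1 - t) * v i) = t • u + (1 - t) • v := by
    ext i; simp
  have hu0 := hf u hu
  have hv0 := hf v hv
  have hB := sqrt_mul_sqrt_le_lorentz s (fun k => N k u) (fun k => N k v) (hl u hu) (hl v hv)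
    hu0 hv0 (h u) (h v)
  have hexp : eval (t • u + (1 - t) • v) f = t ^ 2 * eval u f + (1 - t) ^ 2 * eval v f +
      2 * t * (1 - t) * (l u * l v - ∑ k ∈ s, N k u * N k v) := by
    have hN : ∑ k ∈ s, (t * N k u + (1 - t) * N k v) ^ 2 = t ^ 2 * ∑ k ∈ s, N k u ^ 2 +
        (1 - t) ^ 2 * ∑ k ∈ s, N k v ^ 2 + 2 * t * (1 - t) * ∑ k ∈ s, N k u * N k v := by
      simp only [Finset.mul_sum, ← Finset.sum_add_distrib]
      exact Finset.sum_congr rfl fun k _ => by ring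
    rw [h, h u, h v]
    simp only [map_add, map_smul, smul_eq_mul, hN]
    ring
  have hamgm := Real.geom_mean_le_arith_mean2_weighted ht (sub_nonneg.2 ht')
    (Real.sqrt_nonneg (eval u f)) (Real.sqrt_nonneg (eval v f)) (add_sub_cancel _ _)
  have hsq : eval u f ^ t * eval v f ^ (1 - t) =
      (√(eval u f) ^ t * √(eval v f) ^ (1 - t)) ^ 2 := by
    have key (a r : ℝ) (ha : 0 ≤ a) : a ^ r = (√a ^ r) ^ 2 := by
      rw [← Real.rpow_mul_natCast (Real.sqrt_nonneg a), mul_comm,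
        Real.rpow_natCast_mul (Real.sqrt_nonneg a), Real.sq_sqrt ha]
    rw [mul_pow, ← key _ _ hu0, ← key _ _ hv0]
  rw [hsum, hexp, hsq]
  calc _ ≤ (t * √(eval u f) + (1 - t) * √(eval v f)) ^ 2 :=
        pow_le_pow_left₀ (by positivity) hamgm 2
    _ = t ^ 2 * eval u f + (1 - t) ^ 2 * eval v f +
        2 * t * (1 - t) * (√(eval u f) * √(eval v f)) := by
      linear_combination t ^ 2 * Real.sq_sqrt hu0 + (1 - t) ^ 2 * Real.sq_sqrt hv0
    _ ≤ _ := by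
      have : 0 ≤ 2 * t * (1 - t) := mul_nonneg (by positivity) (sub_nonneg.2 ht')
      gcongr

theorem Finset.sum_offDiag_insert {α : Type*} [Fintype α] [DecidableEq α]
    (F : Finset α → ℝ) :
    ∑ i : α, ∑ j : α, (if i ≠ j then F {i, j} else 0) =
      2 * ∑ S : Finset α, if S.card = 2 then F S else 0 := by
  rw [← Finset.sum_product', ← Finset.sum_filter, ← Finset.sum_filter, Finset.mul_sum,
    ← Finset.sum_fiberwise_of_maps_to (g := fun p : α × α => ({p.1, p.2} : Finset α))
      (t := {S | S.card = 2})]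
  · refine Finset.sum_congr rfl fun S hS => ?_
    obtain ⟨a, b, hab, rfl⟩ := Finset.card_eq_two.1 (Finset.mem_filter.1 hS).2
    have : (({p ∈ Finset.univ ×ˢ Finset.univ | p.1 ≠ p.2} : Finset (α × α)).filter
        fun p => ({p.1, p.2} : Finset α) = {a, b}) = {(a, b), (b, a)} := by
      ext ⟨i, j⟩
      simp only [Finset.mem_filter, Finset.mem_product, Finset.mem_univ, true_and,
        Finset.mem_insert, Finset.mem_singleton, Prod.mk.injEq]
      constructor
      · rintro ⟨hij, h⟩
        have hi : i ∈ ({a, b} : Finset α) := h ▸ by simp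
        have hj : j ∈ ({a, b} : Finset α) := h ▸ by simp
        grind
      · rintro (⟨rfl, rfl⟩ | ⟨rfl, rfl⟩)
        · exact ⟨hab, rfl⟩
        · exact ⟨hab.symm, Finset.pair_comm _ _⟩
    rw [this, Finset.sum_pair (by simp [hab]), Finset.pair_comm b a]
    ring
  · rintro ⟨i, j⟩ h
    simpa using Finset.card_pair (Finset.mem_filter.1 h).2

namespace PaperMatroid

variable {n : ℕ} (M : PaperMatroid n)

theorem indep_empty : M.Indep ∅ :=
  let ⟨_, hS⟩ := M.indep_nonempty
  M.indep_subset (Finset.empty_subset _) hS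

/-- Parallelism of non-loops, extended by equality to an equivalence relation. -/
def parallel : Setoid (Fin n) where
  r i j := i = j ∨ (M.Indep {i} ∧ M.Indep {j} ∧ ¬ M.Indep {i, j})
  iseqv := by
    refine ⟨fun _ => Or.inl rfl, ?_, ?_⟩
    · rintro i j (rfl | ⟨hi, hj, h⟩)
      · exact Or.inl rfl
      · exact Or.inr ⟨hj, hi, by rwa [Finset.pair_comm]⟩
    · rintro i j k (rfl | ⟨hi, hj, hij⟩) (rfl | ⟨hj', hk, hjk⟩)
      · exact Or.inl rfl
      · exact Or.inr ⟨hj', hk, hjk⟩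
      · exact Or.inr ⟨hi, hj, hij⟩
      · by_cases hik : i = k
        · exact Or.inl hik
        · refine Or.inr ⟨hi, hk, fun h => ?_⟩
          obtain ⟨e, he, h'⟩ := M.indep_exchange hj h (by simp [Finset.card_pair hik])
          simp only [Finset.mem_sdiff, Finset.mem_insert, Finset.mem_singleton] at he
          rcases he.1 with rfl | rfl
          · exact hij h'
          · exact hjk (by rwa [Finset.pair_comm])

/-- A representative of the parallel class of an element. -/
noncomputable def parallelRep (i : Fin n) : Fin n := (Quotient.mk M.parallel i).out

theorem parallelRep_eq_iff {i j : Fin n} :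
    M.parallelRep i = M.parallelRep j ↔
      i = j ∨ (M.Indep {i} ∧ M.Indep {j} ∧ ¬ M.Indep {i, j}) :=
  Quotient.out_inj.trans Quotient.eq

open Classical in
/-- The total weight of the non-loops whose parallel class is represented by `k`. -/
noncomputable def classWeight (k : Fin n) : (Fin (n + 1) → ℝ) →ₗ[ℝ] ℝ :=
  ∑ i : Fin n, if M.Indep {i} ∧ M.parallelRep i = k then LinearMap.proj i.succ else 0

open Classical in
/-- The total weight of the non-loops. -/
noncomputable def nonloopWeight : (Fin (n + 1) → ℝ) →ₗ[ℝ] ℝ :=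
  ∑ i : Fin n, if M.Indep {i} then LinearMap.proj i.succ else 0

open Classical in
theorem classWeight_apply (k : Fin n) (x : Fin (n + 1) → ℝ) :
    M.classWeight k x =
      ∑ i : Fin n, if M.parallelRep i = k then (if M.Indep {i} then x i.succ else 0) else 0 := by
  rw [classWeight, LinearMap.sum_apply]
  exact Finset.sum_congr rfl fun i _ => by split_ifs <;> simp_all

open Classical in
theorem nonloopWeight_apply (x : Fin (n + 1) → ℝ) :
    M.nonloopWeight x = ∑ i : Fin n, if M.Indep {i} then x i.succ else 0 := by
  rw [nonloopWeight, LinearMap.sum_apply]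
  exact Finset.sum_congr rfl fun i _ => by split_ifs <;> simp

theorem sum_classWeight (x : Fin (n + 1) → ℝ) :
    ∑ k, M.classWeight k x = M.nonloopWeight x := by
  simp only [classWeight_apply, nonloopWeight_apply]
  rw [Finset.sum_comm]
  simp

open Classical in
theorem two_mul_sum_indep_pairs (x : Fin (n + 1) → ℝ) :
    2 * ∑ S : Finset (Fin n), (if S.card = 2 ∧ M.Indep S then ∏ i ∈ S, x i.succ else 0) =
      M.nonloopWeight x ^ 2 - ∑ k, M.classWeight k x ^ 2 := by
  have hsq : ∑ k, M.classWeight k x ^ 2 = ∑ i : Fin n, ∑ j : Fin n,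
      if M.parallelRep i = M.parallelRep j then
        (if M.Indep {i} then x i.succ else 0) * (if M.Indep {j} then x j.succ else 0) else 0 := by
    simp only [classWeight_apply, sq, Finset.sum_mul_sum]
    rw [Finset.sum_comm]
    refine Finset.sum_congr rfl fun i _ => ?_
    rw [Finset.sum_comm]
    refine Finset.sum_congr rfl fun j _ => ?_
    by_cases h : M.parallelRep i = M.parallelRep j <;> simp [h, ite_mul, eq_comm]
  rw [hsq, nonloopWeight_apply, sq, Finset.sum_mul_sum]
  simp only [ite_and, ← Finset.sum_sub_distrib]
  rw [← Finset.sum_offDiag_insert (fun S => if M.Indep S then ∏ i ∈ S, x i.succ else 0)]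
  refine Finset.sum_congr rfl fun i _ => Finset.sum_congr rfl fun j _ => ?_
  have hi : M.Indep {i, j} → M.Indep {i} := M.indep_subset (by simp)
  have hj : M.Indep {i, j} → M.Indep {j} := M.indep_subset (by simp)
  by_cases hij : i = j
  · simp [hij]
  · simp only [M.parallelRep_eq_iff, Finset.prod_pair hij]
    by_cases h1 : M.Indep {i} <;> by_cases h2 : M.Indep {j} <;> by_cases h3 : M.Indep {i, j} <;>
      simp_all

open Classical in
/-- The quadratic `∂_y^(n-2) g_M / (n-2)!`. -/
noncomputable def quadratic : MvPolynomial (Fin (n + 1)) ℝ :=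
  MvPolynomial.C ((n * (n-1) : ℕ) / 2 : ℝ) * MvPolynomial.X (0 : Fin (n+1)) ^ 2 +
    MvPolynomial.C ((n : ℝ) - 1) *
      ∑ i : Fin n,
        (if M.Indep {i} then MvPolynomial.X 0 * MvPolynomial.X i.succ else 0) +
    ∑ S : Finset (Fin n),
      (if S.card = 2 ∧ M.Indep S then ∏ i ∈ S, MvPolynomial.X i.succ else 0)

open Classical in
theorem eval_quadratic (x : Fin (n + 1) → ℝ) :
    eval x M.quadratic = (n * (n-1) : ℕ) / 2 * x 0 ^ 2 + (n - 1) * (x 0 * M.nonloopWeight x) +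
      ∑ S : Finset (Fin n), (if S.card = 2 ∧ M.Indep S then ∏ i ∈ S, x i.succ else 0) := by
  simp only [quadratic, nonloopWeight_apply, map_add, map_mul, map_sum, map_pow, eval_C, eval_X,
    Finset.mul_sum, apply_ite (eval x), map_prod, map_zero, mul_ite, mul_zero]

theorem nonloopWeight_nonneg {x : Fin (n + 1) → ℝ} (hx : ∀ i, 0 ≤ x i) :
    0 ≤ M.nonloopWeight x := by
  rw [nonloopWeight_apply]
  exact Finset.sum_nonneg fun i _ => by split_ifs <;> simp [hx]

theorem logConcaveOn_quadratic (hn : 2 ≤ n) : LogConcaveOn M.quadratic := by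
  have hn' : (2 : ℝ) ≤ n := by exact_mod_cast hn
  have hcast : ((n * (n - 1) : ℕ) : ℝ) = n * (n - 1) := by
    rw [Nat.cast_mul, Nat.cast_sub (by omega), Nat.cast_one]
  have hpos : (0 : ℝ) ≤ n * (n - 1) := by nlinarith
  refine logConcaveOn_of_lorentz Finset.univ
    (√(n * (n - 1) / 2) • (LinearMap.proj 0 + (n : ℝ)⁻¹ • M.nonloopWeight))
    (fun k => √(1 / 2) • (M.classWeight k - (n : ℝ)⁻¹ • M.nonloopWeight))
    (fun x hx => ?_) (fun x hx => ?_) fun x => ?_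
  · rw [eval_quadratic]
    have h1 : (0 : ℝ) ≤ n - 1 := by linarith
    have h2 := M.nonloopWeight_nonneg hx
    have h0 := hx 0
    refine add_nonneg (by positivity) (Finset.sum_nonneg fun S _ => ?_)
    split_ifs
    · exact Finset.prod_nonneg fun i _ => hx _
    · exact le_rfl
  · have h2 := M.nonloopWeight_nonneg hx
    have h0 := hx 0
    simp only [LinearMap.smul_apply, LinearMap.add_apply, LinearMap.proj_apply, smul_eq_mul]
    positivity
  · have hN : ∑ k, (M.classWeight k x - (n : ℝ)⁻¹ * M.nonloopWeight x) ^ 2 =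
        ∑ k, M.classWeight k x ^ 2 - (n : ℝ)⁻¹ * M.nonloopWeight x ^ 2 := by
      simp only [sub_sq, Finset.sum_add_distrib, Finset.sum_sub_distrib, ← Finset.sum_mul,
        ← Finset.mul_sum, sum_classWeight, Finset.sum_const, Finset.card_univ, Fintype.card_fin,
        nsmul_eq_mul]
      field_simp
      ring
    have hpair := M.two_mul_sum_indep_pairs x
    simp only [LinearMap.smul_apply, LinearMap.add_apply, LinearMap.sub_apply,
      LinearMap.proj_apply, smul_eq_mul, mul_pow, ← Finset.mul_sum, hN]
    rw [Real.sq_sqrt (by positivity), Real.sq_sqrt (by positivity), eval_quadratic, hcast]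
    rw [eq_div_of_mul_eq two_ne_zero ((mul_comm _ _).trans hpair)]
    field_simp
    ring

end PaperMatroid

theorem MvPolynomial.iterate_pderiv_X_pow_mul {σ R : Type*} [CommSemiring R] (i : σ)
    {q : MvPolynomial σ R} (hq : pderiv i q = 0) (m k : ℕ) :
    (fun p => pderiv i p)^[k] (X i ^ m * q) = C (m.descFactorial k : R) * (X i ^ (m - k) * q) := by
  induction k with
  | zero => simp
  | succ k ih =>
    rw [Function.iterate_succ_apply', ih, Nat.descFactorial_succ]
    simp only [pderiv_mul, pderiv_C, pderiv_pow, pderiv_X_self, hq]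
    push_cast
    simp only [C_mul, map_natCast, Nat.sub_sub]
    ring

theorem MvPolynomial.iterate_pderiv_sum {σ R ι : Type*} [CommSemiring R] (i : σ)
    (s : Finset ι) (f : ι → MvPolynomial σ R) (k : ℕ) :
    (fun p => pderiv i p)^[k] (∑ a ∈ s, f a) = ∑ a ∈ s, (fun p => pderiv i p)^[k] (f a) := by
  induction k with
  | zero => simp
  | succ k ih => simp only [Function.iterate_succ_apply', ih, map_sum]

theorem MvPolynomial.pderiv_zero_prod_X_succ {n : ℕ} (S : Finset (Fin n)) :
    pderiv (0 : Fin (n + 1)) (∏ i ∈ S, X i.succ : MvPolynomial (Fin (n + 1)) ℝ) = 0 := by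
  classical
  induction S using Finset.induction_on with
  | empty => simp
  | insert a S ha ih =>
    rw [Finset.prod_insert ha, pderiv_mul, ih, pderiv_X_of_ne (Fin.succ_ne_zero a)]
    simp

theorem PaperMatroid.iterate_pderiv_gM {n : ℕ} (hn : 2 ≤ n) (M : PaperMatroid n) :
    (fun p => pderiv (0 : Fin (n + 1)) p)^[n - 2] (gM M) =
      C ((n - 2).factorial : ℝ) * M.quadratic := by
  classical
  obtain ⟨m, rfl⟩ := Nat.exists_eq_add_of_le' hn
  have hterm (S : Finset (Fin (m + 2))) :
      (fun p => pderiv (0 : Fin (m + 2 + 1)) p)^[m] (if M.Indep S then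
        X 0 ^ (m + 2 - S.card) * ∏ i ∈ S, X i.succ else 0) =
      C (m.factorial : ℝ) * ((if S = ∅ then
          C (((m + 2) * (m + 2 - 1) : ℕ) / 2 : ℝ) * X (0 : Fin (m + 2 + 1)) ^ 2 else 0) +
        C (((m + 2 : ℕ) : ℝ) - 1) * (∑ i : Fin (m + 2), if S = {i} then
          (if M.Indep {i} then X 0 * X i.succ else 0) else 0) +
        (if S.card = 2 ∧ M.Indep S then ∏ i ∈ S, X i.succ else 0)) := by
    by_cases hS : M.Indep S
    · rw [if_pos hS, iterate_pderiv_X_pow_mul 0 (pderiv_zero_prod_X_succ S)]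
      obtain h | h | h | h : S.card = 0 ∨ S.card = 1 ∨ S.card = 2 ∨ 3 ≤ S.card := by omega
      · obtain rfl := Finset.card_eq_zero.1 h
        have hd : ((m + 2).descFactorial m : ℝ) =
            m.factorial * (((m + 2) * (m + 2 - 1) : ℕ) / 2 : ℝ) := by
          have := Nat.factorial_mul_descFactorial (n := m + 2) (k := m) (by omega)
          simp only [Nat.add_sub_cancel_left, Nat.factorial] at this
          have h' : (2 * (m + 2).descFactorial m : ℝ) = (m + 2) * ((m + 1) * m.factorial) := by
            exact_mod_cast this
          push_cast [show m + 2 - 1 = m + 1 from rfl]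
          linarith
        have he (i : Fin (m + 2)) : (∅ : Finset (Fin (m + 2))) ≠ {i} :=
          (Finset.singleton_ne_empty i).symm
        simp [he, hd, mul_assoc]
      · obtain ⟨a, rfl⟩ := Finset.card_eq_one.1 h
        have hd : ((m + 1).descFactorial m : ℝ) = m.factorial * (((m + 2 : ℕ) : ℝ) - 1) := by
          have := Nat.factorial_mul_descFactorial (n := m + 1) (k := m) (by omega)
          simp only [Nat.add_sub_cancel_left, Nat.factorial] at this
          have h' : ((m + 1).descFactorial m : ℝ) = (m + 1) * m.factorial := by
            exact_mod_cast by simpa using this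
          rw [h']; push_cast; ring
        simp only [Finset.card_singleton, show m + 2 - 1 = m + 1 from rfl, hd, C_mul,
          Nat.add_sub_cancel_left]
        simp [hS, mul_assoc]
      · have h1 : S ≠ ∅ := by rintro rfl; simp at h
        have h2 (i : Fin (m + 2)) : S ≠ {i} := by rintro rfl; simp at h
        simp [h, h1, h2, hS, Nat.descFactorial_self]
      · have h1 : S ≠ ∅ := by rintro rfl; simp at h
        have h2 (i : Fin (m + 2)) : S ≠ {i} := by rintro rfl; simp at h
        have hle : S.card ≤ m + 2 := by simpa using Finset.card_le_univ S
        have hd : (m + 2 - S.card).descFactorial m = 0 :=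
          Nat.descFactorial_eq_zero_iff_lt.2 (by omega)
        simp [hd, h1, h2, show S.card ≠ 2 by omega]
    · have h1 : S ≠ ∅ := by rintro rfl; exact hS M.indep_empty
      have h2 (i : Fin (m + 2)) :
          (if S = {i} then (if M.Indep {i} then X 0 * X i.succ else 0) else 0 :
            MvPolynomial (Fin (m + 2 + 1)) ℝ) = 0 := by
        split_ifs with hi hi'
        · exact absurd (hi ▸ hi') hS
        all_goals rfl
      simp only [hS, h1, h2, if_false, and_false, Finset.sum_const_zero, mul_zero, add_zero]
      exact Function.iterate_fixed (map_zero _) _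
  simp only [Nat.add_sub_cancel]
  rw [gM, iterate_pderiv_sum, Finset.sum_congr rfl fun S _ => hterm S, ← Finset.mul_sum,
    Finset.sum_add_distrib, Finset.sum_add_distrib, ← Finset.mul_sum, Finset.sum_comm]
  simp [quadratic]

/- For any matroid `M` on `n ≥ 2` elements, the quadratic `∂_y^(n−2) g_M` is
log-concave over `ℝ_{≥0}^(n+1)`; explicitly, the quadratic
`(n(n−1)/2)·y² + (n−1)·∑_{{i} ∈ 𝓘} y·z_i + ∑_{{i,j} ∈ 𝓘} z_i·z_j` is log-concave
over `ℝ_{≥0}^(n+1)`. -/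
open Classical in
theorem quadratic_deriv_gM_logConcave {n : ℕ} (hn : 2 ≤ n) (M : PaperMatroid n) :
    LogConcaveOn ((fun p => MvPolynomial.pderiv (0 : Fin (n+1)) p)^[n-2] (gM M)) ∧
    LogConcaveOn
      (MvPolynomial.C ((n * (n-1) : ℕ) / 2 : ℝ) * MvPolynomial.X (0 : Fin (n+1)) ^ 2 +
        MvPolynomial.C ((n : ℝ) - 1) *
          ∑ i : Fin n,
            (if M.Indep {i} then MvPolynomial.X 0 * MvPolynomial.X i.succ else 0) +
        ∑ S : Finset (Fin n),
          (if S.card = 2 ∧ M.Indep S then ∏ i ∈ S, MvPolynomial.X i.succ else 0)) := by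
  have h := M.logConcaveOn_quadratic hn
  exact ⟨M.iterate_pderiv_gM hn ▸ h.C_mul (Nat.cast_nonneg _), h⟩
end

section
/- Let f, g ∈ ℝ[z_1,…,z_n] be homogeneous polynomials with nonnegative coefficients such that D_b f = D_c g ≠ 0 for some vectors b, c ∈ ℝ_{≥0}^n. If f and g are log-concave over ℝ_{≥0}^n, then f + g is log-concave over ℝ_{≥0}^n. -/
open Matrix MvPolynomial

/-- The directional derivative operator `D_v = ∑ i, v i • ∂_i`. -/
noncomputable def dirDeriv {m : ℕ} (v : Fin m → ℝ) (f : MvPolynomial (Fin m) ℝ) :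
    MvPolynomial (Fin m) ℝ :=
  ∑ i, MvPolynomial.C (v i) * MvPolynomial.pderiv i f

namespace MvPolynomial

variable {n : ℕ}

theorem pderiv_pderiv_comm (i j : Fin n) (f : MvPolynomial (Fin n) ℝ) :
    pderiv i (pderiv j f) = pderiv j (pderiv i f) := by
  ext m
  simp only [coeff_pderiv]
  rcases eq_or_ne i j with rfl | hij
  · rfl
  · simp [hij, hij.symm, add_right_comm m]
    ring

theorem eval_pos_of_coeff_nonneg {f : MvPolynomial (Fin n) ℝ} (hf : ∀ m, 0 ≤ f.coeff m)
    (hne : f ≠ 0) {a : Fin n → ℝ} (ha : ∀ i, 0 < a i) : 0 < eval a f := by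
  rw [eval_eq]
  refine Finset.sum_pos (fun m hm => mul_pos ?_ (Finset.prod_pos fun i _ => pow_pos (ha i) _)) ?_
  · exact (hf m).lt_of_ne' (mem_support_iff.1 hm)
  · exact support_nonempty.2 hne

theorem eval_nonneg_of_coeff_nonneg {f : MvPolynomial (Fin n) ℝ} (hf : ∀ m, 0 ≤ f.coeff m)
    {a : Fin n → ℝ} (ha : ∀ i, 0 ≤ a i) : 0 ≤ eval a f := by
  rw [eval_eq]
  exact Finset.sum_nonneg fun m _ =>
    mul_nonneg (hf m) (Finset.prod_nonneg fun i _ => pow_nonneg (ha i) _)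

end MvPolynomial

section DirDeriv

variable {n : ℕ}

theorem dirDeriv_add_left (v w : Fin n → ℝ) (f : MvPolynomial (Fin n) ℝ) :
    dirDeriv (v + w) f = dirDeriv v f + dirDeriv w f := by
  simp [dirDeriv, add_mul, Finset.sum_add_distrib]

theorem dirDeriv_smul_left (s : ℝ) (v : Fin n → ℝ) (f : MvPolynomial (Fin n) ℝ) :
    dirDeriv (s • v) f = C s * dirDeriv v f := by
  simp [dirDeriv, Finset.mul_sum, mul_assoc]

theorem dirDeriv_add_right (v : Fin n → ℝ) (f g : MvPolynomial (Fin n) ℝ) :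
    dirDeriv v (f + g) = dirDeriv v f + dirDeriv v g := by
  simp [dirDeriv, mul_add, Finset.sum_add_distrib]

theorem dirDeriv_C_mul (v : Fin n → ℝ) (s : ℝ) (f : MvPolynomial (Fin n) ℝ) :
    dirDeriv v (C s * f) = C s * dirDeriv v f := by
  simp only [dirDeriv, pderiv_C_mul, Finset.mul_sum]
  exact Finset.sum_congr rfl fun i _ => by ring

theorem dirDeriv_C (v : Fin n → ℝ) (s : ℝ) : dirDeriv v (C s) = 0 := by
  simp [dirDeriv]

theorem dirDeriv_mul (v : Fin n → ℝ) (f g : MvPolynomial (Fin n) ℝ) :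
    dirDeriv v (f * g) = dirDeriv v f * g + f * dirDeriv v g := by
  simp only [dirDeriv, pderiv_mul, Finset.mul_sum, Finset.sum_mul, ← Finset.sum_add_distrib]
  exact Finset.sum_congr rfl fun i _ => by ring

theorem dirDeriv_X (v : Fin n → ℝ) (i : Fin n) : dirDeriv v (X i) = C (v i) := by
  simp [dirDeriv, Pi.single_apply]

theorem dirDeriv_comm (v w : Fin n → ℝ) (f : MvPolynomial (Fin n) ℝ) :
    dirDeriv v (dirDeriv w f) = dirDeriv w (dirDeriv v f) := by
  simp only [dirDeriv, map_sum, pderiv_C_mul, Finset.mul_sum]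
  rw [Finset.sum_comm]
  refine Finset.sum_congr rfl fun i _ => Finset.sum_congr rfl fun j _ => ?_
  rw [pderiv_pderiv_comm]
  ring

theorem MvPolynomial.IsHomogeneous.dirDeriv {f : MvPolynomial (Fin n) ℝ} {d : ℕ}
    (hf : f.IsHomogeneous d) (v : Fin n → ℝ) : (dirDeriv v f).IsHomogeneous (d - 1) :=
  IsHomogeneous.sum _ _ _ fun _ _ => hf.pderiv.C_mul _

theorem dirDeriv_eq_zero_of_isHomogeneous_zero {f : MvPolynomial (Fin n) ℝ}
    (hf : f.IsHomogeneous 0) (v : Fin n → ℝ) : dirDeriv v f = 0 := by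
  rw [← totalDegree_zero_iff_isHomogeneous, totalDegree_eq_zero_iff_eq_C] at hf
  rw [hf, dirDeriv_C]

theorem eval_dirDeriv_self {f : MvPolynomial (Fin n) ℝ} {d : ℕ} (hf : f.IsHomogeneous d)
    (a : Fin n → ℝ) : eval a (dirDeriv a f) = d * eval a f := by
  simpa [dirDeriv] using congrArg (eval a) hf.sum_X_mul_pderiv

theorem coeff_dirDeriv_nonneg {f : MvPolynomial (Fin n) ℝ} (hf : ∀ m, 0 ≤ f.coeff m)
    {v : Fin n → ℝ} (hv : ∀ i, 0 ≤ v i) (m : Fin n →₀ ℕ) : 0 ≤ (dirDeriv v f).coeff m := by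
  simp only [dirDeriv, coeff_sum, coeff_C_mul, coeff_pderiv]
  exact Finset.sum_nonneg fun i _ => mul_nonneg (hv i) (mul_nonneg (hf _) (by positivity))

theorem hasDerivAt_eval_add_smul (f : MvPolynomial (Fin n) ℝ) (u x : Fin n → ℝ) (t : ℝ) :
    HasDerivAt (fun s : ℝ => eval (u + s • x) f) (eval (u + t • x) (dirDeriv x f)) t := by
  induction f using MvPolynomial.induction_on with
  | C r => simpa [dirDeriv_C] using hasDerivAt_const t r
  | add p q hp hq => simpa [dirDeriv_add_right] using hp.fun_add hq
  | mul_X p i hp =>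
    have hX : HasDerivAt (fun s : ℝ => u i + s * x i) (x i) t := by
      simpa using ((hasDerivAt_id t).mul_const (x i)).const_add (u i)
    simpa [dirDeriv_mul, dirDeriv_X] using hp.fun_mul hX

/-- Second-order expansion of a second directional derivative. -/
theorem eval_dirDeriv_dirDeriv_add_smul (f : MvPolynomial (Fin n) ℝ) (a x y : Fin n → ℝ)
    (s : ℝ) : eval a (dirDeriv (x + s • y) (dirDeriv (x + s • y) f)) =
      eval a (dirDeriv x (dirDeriv x f)) + 2 * s * eval a (dirDeriv x (dirDeriv y f)) +
        s ^ 2 * eval a (dirDeriv y (dirDeriv y f)) := by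
  simp only [dirDeriv_add_left, dirDeriv_smul_left, dirDeriv_add_right, dirDeriv_C_mul,
    map_add, map_mul, eval_C, dirDeriv_comm y x]
  ring

end DirDeriv

section LogConcave

variable {n : ℕ}

theorem LogConcaveOn.mul_le_sq {f : MvPolynomial (Fin n) ℝ} (hf : LogConcaveOn f)
    {u v : Fin n → ℝ} (hu : ∀ i, 0 ≤ u i) (hv : ∀ i, 0 ≤ v i) :
    eval u f * eval v f ≤ eval ((1 / 2 : ℝ) • (u + v)) f ^ 2 := by
  have h := hf.2 u v hu hv (1 / 2) (by norm_num) (by norm_num)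
  have hfu := hf.1 u hu
  have hfv := hf.1 v hv
  have hw : (fun i => 1 / 2 * u i + (1 - 1 / 2) * v i) = (1 / 2 : ℝ) • (u + v) := by
    ext i; simp; ring
  rw [hw, show (1 - 1 / 2 : ℝ) = 1 / 2 by norm_num, ← Real.sqrt_eq_rpow, ← Real.sqrt_eq_rpow] at h
  have h2 := pow_le_pow_left₀ (by positivity) h 2
  rwa [mul_pow, Real.sq_sqrt hfu, Real.sq_sqrt hfv] at h2

theorem LogConcaveOn.eval_mul_dirDeriv_dirDeriv_le {f : MvPolynomial (Fin n) ℝ}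
    (hf : LogConcaveOn f) {a : Fin n → ℝ} (ha : ∀ i, 0 < a i) (x : Fin n → ℝ) :
    eval a f * eval a (dirDeriv x (dirDeriv x f)) ≤ eval a (dirDeriv x f) ^ 2 := by
  by_contra! hlt
  have hneg (p : MvPolynomial (Fin n) ℝ) (t : ℝ) :
      HasDerivAt (fun s : ℝ => eval (a + (-s) • x) p) (-eval (a + (-t) • x) (dirDeriv x p)) t := by
    simpa [Function.comp_def] using (hasDerivAt_eval_add_smul p a x (-t)).scomp t (hasDerivAt_neg t)
  set ψ : ℝ → ℝ := fun t => eval (a + t • x) f * eval (a + (-t) • x) f with hψ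
  have h1 (t : ℝ) := (hasDerivAt_eval_add_smul f a x t).fun_mul (hneg f t)
  have hd : deriv ψ = fun t => eval (a + t • x) (dirDeriv x f) * eval (a + (-t) • x) f +
      eval (a + t • x) f * -eval (a + (-t) • x) (dirDeriv x f) := funext fun t => (h1 t).deriv
  have h2 := ((hasDerivAt_eval_add_smul (dirDeriv x f) a x 0).fun_mul (hneg f 0)).fun_add
    ((hasDerivAt_eval_add_smul f a x 0).fun_mul (hneg (dirDeriv x f) 0).fun_neg)
  have hdd : 0 < deriv (deriv ψ) 0 := by
    rw [hd, h2.deriv]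
    simp only [neg_zero, zero_smul, add_zero]
    nlinarith
  have hmin : IsLocalMin ψ 0 := by
    refine isLocalMin_of_deriv_deriv_pos hdd ?_ (h1 0).continuousAt
    rw [hd]
    simp only [neg_zero, zero_smul, add_zero]
    ring
  have hpos : ∀ᶠ t : ℝ in nhds 0, ∀ i, 0 ≤ (a + t • x) i ∧ 0 ≤ (a + (-t) • x) i := by
    refine Filter.eventually_all.2 fun i => Filter.Eventually.and ?_ ?_
    · have : Filter.Tendsto (fun t : ℝ => a i + t * x i) (nhds 0) (nhds (a i)) := by
        simpa using (by fun_prop : Continuous fun t : ℝ => a i + t * x i).tendsto 0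
      filter_upwards [this.eventually_const_lt (ha i)] with t ht using by simpa using ht.le
    · have : Filter.Tendsto (fun t : ℝ => a i + (-t) * x i) (nhds 0) (nhds (a i)) := by
        simpa using (by fun_prop : Continuous fun t : ℝ => a i + (-t) * x i).tendsto 0
      filter_upwards [this.eventually_const_lt (ha i)] with t ht using by simpa using ht.le
  have hconst : ψ =ᶠ[nhds 0] fun _ => ψ 0 := by
    filter_upwards [hmin, hpos] with t ht ht'
    refine le_antisymm ?_ ht
    have h := hf.mul_le_sq (fun i => (ht' i).1) (fun i => (ht' i).2)
    have hm : (1 / 2 : ℝ) • (a + t • x + (a + (-t) • x)) = a := by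
      ext i; simp; ring
    rw [hm] at h
    simpa [hψ, sq] using h
  have hzero : deriv (deriv ψ) 0 = 0 := by
    rw [hconst.deriv.deriv_eq]
    simp
  exact hdd.ne' hzero

/-- The Hessian of a log-concave polynomial is nonpositive on the kernel of its product with
a nonnegative vector `b` such that `D_b f ≠ 0`. -/
theorem LogConcaveOn.dirDeriv_dirDeriv_nonpos {f : MvPolynomial (Fin n) ℝ}
    (hf : LogConcaveOn f) (hfc : ∀ m, 0 ≤ f.coeff m) {a b x : Fin n → ℝ} (ha : ∀ i, 0 < a i)
    (hb : ∀ i, 0 ≤ b i) (hne : dirDeriv b f ≠ 0) (hx : eval a (dirDeriv x (dirDeriv b f)) = 0) :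
    eval a (dirDeriv x (dirDeriv x f)) ≤ 0 := by
  have hf0 : f ≠ 0 := by
    rintro rfl
    simp [dirDeriv] at hne
  have hfa := eval_pos_of_coeff_nonneg hfc hf0 ha
  have hbc := coeff_dirDeriv_nonneg hfc hb
  have hba := eval_pos_of_coeff_nonneg hbc hne ha
  have hbb := eval_nonneg_of_coeff_nonneg (coeff_dirDeriv_nonneg hbc hb) fun i => (ha i).le
  set s := -eval a (dirDeriv x f) / eval a (dirDeriv b f) with hs
  have hz : eval a (dirDeriv (x + s • b) f) = 0 := by
    simp only [dirDeriv_add_left, dirDeriv_smul_left, map_add, map_mul, eval_C, hs]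
    field_simp
    ring
  have h := hf.eval_mul_dirDeriv_dirDeriv_le ha (x + s • b)
  rw [hz, eval_dirDeriv_dirDeriv_add_smul, hx] at h
  have h' := nonpos_of_mul_nonpos_right (h.trans_eq (by norm_num)) hfa
  nlinarith [mul_nonneg (sq_nonneg s) hbb]

/-- A polynomial that is positive and satisfies the second-order log-concavity condition on the
open orthant is log-concave on the closed orthant. -/
theorem logConcaveOn_of_eval_mul_dirDeriv_dirDeriv_le {h : MvPolynomial (Fin n) ℝ}
    (hnonneg : ∀ x : Fin n → ℝ, (∀ i, 0 ≤ x i) → 0 ≤ eval x h)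
    (hpos : ∀ a : Fin n → ℝ, (∀ i, 0 < a i) → 0 < eval a h)
    (hle : ∀ a : Fin n → ℝ, (∀ i, 0 < a i) → ∀ x,
      eval a h * eval a (dirDeriv x (dirDeriv x h)) ≤ eval a (dirDeriv x h) ^ 2) :
    LogConcaveOn h := by
  have hopen (u v : Fin n → ℝ) (hu : ∀ i, 0 < u i) (hv : ∀ i, 0 < v i) (t : ℝ) (ht0 : 0 ≤ t)
      (ht1 : t ≤ 1) : eval u h ^ t * eval v h ^ (1 - t) ≤ eval (v + t • (u - v)) h := by
    have hseg (s : ℝ) (hs : s ∈ Set.Icc (0 : ℝ) 1) (i : Fin n) : 0 < (v + s • (u - v)) i := by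
      have h1 := hu i
      have h2 := hv i
      simp only [Pi.add_apply, Pi.smul_apply, Pi.sub_apply, smul_eq_mul]
      rcases hs.1.eq_or_lt with h0 | h0
      · simpa [← h0] using h2
      · nlinarith [mul_pos h0 h1, mul_nonneg (sub_nonneg.2 hs.2) h2.le]
    have hconc : ConcaveOn ℝ (Set.Icc 0 1) fun s : ℝ => Real.log (eval (v + s • (u - v)) h) := by
      have hd (s : ℝ) (hs : s ∈ Set.Icc (0 : ℝ) 1) :=
        (hasDerivAt_eval_add_smul h v (u - v) s).log (hpos _ (hseg s hs)).ne'
      have hd2 (s : ℝ) (hs : s ∈ Set.Icc (0 : ℝ) 1) :=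
        (hasDerivAt_eval_add_smul (dirDeriv (u - v) h) v (u - v) s).fun_div
          (hasDerivAt_eval_add_smul h v (u - v) s) (hpos _ (hseg s hs)).ne'
      refine concaveOn_of_hasDerivWithinAt2_nonpos (convex_Icc 0 1)
        (fun s hs => (hd s hs).continuousAt.continuousWithinAt)
        (fun s hs => (hd s (interior_subset hs)).hasDerivWithinAt)
        (fun s hs => (hd2 s (interior_subset hs)).hasDerivWithinAt) fun s hs => ?_
      have := hle _ (hseg s (interior_subset hs)) (u - v)
      exact div_nonpos_of_nonpos_of_nonneg (by nlinarith) (sq_nonneg _)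
    have hlog := hconc.2 (Set.right_mem_Icc.2 zero_le_one) (Set.left_mem_Icc.2 zero_le_one)
      ht0 (sub_nonneg.2 ht1) (by ring)
    simp only [smul_eq_mul, mul_one, mul_zero, add_zero, one_smul, zero_smul,
      add_sub_cancel] at hlog
    have hup := hpos u hu
    have hvp := hpos v hv
    rw [← Real.log_le_log_iff (by positivity) (hpos _ (hseg t ⟨ht0, ht1⟩)),
      Real.log_mul (by positivity) (by positivity), Real.log_rpow hup, Real.log_rpow hvp]
    exact hlog
  refine ⟨hnonneg, fun u v hu hv t ht0 ht1 => ?_⟩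
  have hcont (w : Fin n → ℝ) : Filter.Tendsto (fun ε : ℝ => eval (w + ε • 1) h)
      (nhdsWithin 0 (Set.Ioi 0)) (nhds (eval w h)) := by
    have := (hasDerivAt_eval_add_smul h w 1 0).continuousAt.tendsto
    simp only [zero_smul, add_zero] at this
    exact this.mono_left nhdsWithin_le_nhds
  have hw : (fun i => t * u i + (1 - t) * v i) = v + t • (u - v) := by
    ext i; simp; ring
  rw [hw]
  refine le_of_tendsto_of_tendsto (((hcont u).rpow_const (Or.inr ht0)).mul
    ((hcont v).rpow_const (Or.inr (sub_nonneg.2 ht1)))) (hcont _) ?_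
  filter_upwards [self_mem_nhdsWithin] with ε hε
  have hε' : 0 < ε := hε
  have := hopen (u + ε • 1) (v + ε • 1)
    (fun i => by simpa using add_pos_of_nonneg_of_pos (hu i) hε')
    (fun i => by simpa using add_pos_of_nonneg_of_pos (hv i) hε') t ht0 ht1
  rwa [add_sub_add_right_eq_sub, add_right_comm] at this

end LogConcave

/-- If `f, g` are homogeneous with nonnegative coefficients, `D_b f = D_c g ≠ 0` for
some `b, c ∈ ℝ_{≥0}^n`, and `f` and `g` are log-concave on `ℝ_{≥0}^n`, then so is
`f + g`. -/
theorem logConcaveOn_add {n : ℕ} (f g : MvPolynomial (Fin n) ℝ) (d₁ d₂ : ℕ)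
    (hf : f.IsHomogeneous d₁) (hg : g.IsHomogeneous d₂)
    (hfc : ∀ m, 0 ≤ f.coeff m) (hgc : ∀ m, 0 ≤ g.coeff m)
    (b c : Fin n → ℝ) (hb : ∀ i, 0 ≤ b i) (hc : ∀ i, 0 ≤ c i)
    (heq : dirDeriv b f = dirDeriv c g) (hne : dirDeriv b f ≠ 0)
    (hlf : LogConcaveOn f) (hlg : LogConcaveOn g) :
    LogConcaveOn (f + g) := by
  have hf0 : f ≠ 0 := by
    rintro rfl
    simp [dirDeriv] at hne
  have hd₁ : d₁ ≠ 0 := by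
    rintro rfl
    exact hne (dirDeriv_eq_zero_of_isHomogeneous_zero hf b)
  have hd₂ : d₂ ≠ 0 := by
    rintro rfl
    exact hne (heq.trans (dirDeriv_eq_zero_of_isHomogeneous_zero hg c))
  have hd : d₁ - 1 = d₂ - 1 := (hf.dirDeriv b).inj_right (heq ▸ hg.dirDeriv c) hne
  obtain rfl : d₁ = d₂ := by omega
  obtain ⟨d, rfl⟩ := Nat.exists_eq_succ_of_ne_zero hd₁
  have hh : (f + g).IsHomogeneous (d + 1) := hf.add hg
  have hpos (a : Fin n → ℝ) (ha : ∀ i, 0 < a i) : 0 < eval a (f + g) := by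
    rw [map_add]
    exact add_pos_of_pos_of_nonneg (eval_pos_of_coeff_nonneg hfc hf0 ha)
      (hlg.1 a fun i => (ha i).le)
  refine logConcaveOn_of_eval_mul_dirDeriv_dirDeriv_le
    (fun x hx => by rw [map_add]; exact add_nonneg (hlf.1 x hx) (hlg.1 x hx)) hpos
    fun a ha x => ?_
  rcases Nat.eq_zero_or_pos d with rfl | hdpos
  · rw [dirDeriv_eq_zero_of_isHomogeneous_zero (hh.dirDeriv x) x]
    simpa using sq_nonneg _
  have hL : 0 < eval a (dirDeriv a (dirDeriv b f)) := by
    rw [eval_dirDeriv_self (hf.dirDeriv b)]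
    exact mul_pos (by simpa using hdpos)
      (eval_pos_of_coeff_nonneg (coeff_dirDeriv_nonneg hfc hb) hne ha)
  obtain ⟨s, z, rfl, hz⟩ : ∃ (s : ℝ) (z : Fin n → ℝ), x = z + s • a ∧
      eval a (dirDeriv z (dirDeriv b f)) = 0 := by
    refine ⟨eval a (dirDeriv x (dirDeriv b f)) / eval a (dirDeriv a (dirDeriv b f)),
      x + (-(eval a (dirDeriv x (dirDeriv b f)) / eval a (dirDeriv a (dirDeriv b f)))) • a,
      by simp, ?_⟩
    simp only [dirDeriv_add_left, dirDeriv_smul_left, map_add, map_mul, eval_C]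
    field_simp
    ring
  have hzz : eval a (dirDeriv z (dirDeriv z (f + g))) ≤ 0 := by
    simp only [dirDeriv_add_right, map_add]
    exact add_nonpos (hlf.dirDeriv_dirDeriv_nonpos hfc ha hb hne hz)
      (hlg.dirDeriv_dirDeriv_nonpos hgc ha hc (heq ▸ hne) (heq ▸ hz))
  have hza : eval a (dirDeriv z (dirDeriv a (f + g))) = d * eval a (dirDeriv z (f + g)) := by
    rw [dirDeriv_comm, eval_dirDeriv_self (hh.dirDeriv z), Nat.add_sub_cancel]
  have haa : eval a (dirDeriv a (dirDeriv a (f + g))) = d * ((d + 1) * eval a (f + g)) := by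
    rw [eval_dirDeriv_self (hh.dirDeriv a), eval_dirDeriv_self hh, Nat.add_sub_cancel]
    push_cast
    ring
  rw [eval_dirDeriv_dirDeriv_add_smul, hza, haa, dirDeriv_add_left, dirDeriv_smul_left,
    map_add (eval a) (dirDeriv z (f + g)), map_mul (eval a), eval_C, eval_dirDeriv_self hh]
  have hp := hpos a ha
  push_cast
  generalize eval a (f + g) = H at *
  generalize eval a (dirDeriv z (f + g)) = Z at *
  have hd0 : (0 : ℝ) ≤ d := d.cast_nonneg
  nlinarith [mul_nonpos_of_nonneg_of_nonpos hp.le hzz, sq_nonneg (Z + s * H),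
    mul_nonneg hd0 (sq_nonneg (s * H))]
end
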